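/- (Theorem 4.2, part 1: boundedness) Under the standing hypotheses with ρ = ∞ (i.e. F'(z) ≤ k for all z ∈ ℝ) and τ = 0 (so a ≤ A is bounded by a constant), if ∫₀^∞ dt/g(t) = ∞ and either C'(t) ≤ 0 for all t ≥ 0 or C'(t) → 0 as t → ∞, then the solutions are bounded: there exists κ ≥ 0 such that for every δ > 0 and every t₀ ≥ κ there exists β̃(δ, t₀) > 0 such that every classical solution u on [t₀,∞) with d(t₀) ≤ δ satisfies d(t) < β̃(δ, t₀) for all t ≥ t₀. -/

import Mathlib

open Real Set MeasureTheory Filter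

/-- A classical solution on `[t₀, ∞)` of the initial-boundary-value problem
`-ε(t) u_xxt + u_tt - C(t) u_xx + a' u_t = F(u) - a u_t` on `(0,π) × (t₀,∞)`,
with Dirichlet boundary conditions `u(0,t) = u(π,t) = 0`.  The partial
derivatives are recorded as data, together with the hypotheses that they really
are the derivatives and that all of them are continuous on the closed
space-time domain. -/
structure ClassicalSolution (ε C F : ℝ → ℝ) (a' t₀ : ℝ) where
  u : ℝ → ℝ → ℝ
  ux : ℝ → ℝ → ℝ
  uxx : ℝ → ℝ → ℝ
  ut : ℝ → ℝ → ℝ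
  utt : ℝ → ℝ → ℝ
  uxxt : ℝ → ℝ → ℝ
  aa : ℝ → ℝ → ℝ
  hux : ∀ t ∈ Ici t₀, ∀ x ∈ Icc (0:ℝ) π,
    HasDerivWithinAt (fun y => u y t) (ux x t) (Icc 0 π) x
  huxx : ∀ t ∈ Ici t₀, ∀ x ∈ Icc (0:ℝ) π,
    HasDerivWithinAt (fun y => ux y t) (uxx x t) (Icc 0 π) x
  hut : ∀ x ∈ Icc (0:ℝ) π, ∀ t ∈ Ici t₀,
    HasDerivWithinAt (fun s => u x s) (ut x t) (Ici t₀) t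
  hutt : ∀ x ∈ Icc (0:ℝ) π, ∀ t ∈ Ici t₀,
    HasDerivWithinAt (fun s => ut x s) (utt x t) (Ici t₀) t
  huxxt : ∀ x ∈ Icc (0:ℝ) π, ∀ t ∈ Ici t₀,
    HasDerivWithinAt (fun s => uxx x s) (uxxt x t) (Ici t₀) t
  cont_u : ContinuousOn (Function.uncurry u) (Icc 0 π ×ˢ Ici t₀)
  cont_ux : ContinuousOn (Function.uncurry ux) (Icc 0 π ×ˢ Ici t₀)
  cont_uxx : ContinuousOn (Function.uncurry uxx) (Icc 0 π ×ˢ Ici t₀)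
  cont_ut : ContinuousOn (Function.uncurry ut) (Icc 0 π ×ˢ Ici t₀)
  cont_utt : ContinuousOn (Function.uncurry utt) (Icc 0 π ×ˢ Ici t₀)
  cont_uxxt : ContinuousOn (Function.uncurry uxxt) (Icc 0 π ×ˢ Ici t₀)
  cont_aa : ContinuousOn (Function.uncurry aa) (Icc 0 π ×ˢ Ici t₀)
  aa_nonneg : ∀ x ∈ Icc (0:ℝ) π, ∀ t ∈ Ici t₀, 0 ≤ aa x t
  pde : ∀ x ∈ Ioo (0:ℝ) π, ∀ t ∈ Ioi t₀,
    -(ε t) * uxxt x t + utt x t - C t * uxx x t + a' * ut x t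
      = F (u x t) - aa x t * ut x t
  bc0 : ∀ t ∈ Ici t₀, u 0 t = 0
  bcπ : ∀ t ∈ Ici t₀, u π t = 0
/-- The time-dependent norm `d(t)` of a solution:
`d(t)² = ∫₀^π [ε(t)² u_xx² + u_x² + u² + u_t²] dx`. -/
noncomputable def ClassicalSolution.d {ε C F : ℝ → ℝ} {a' t₀ : ℝ}
    (S : ClassicalSolution ε C F a' t₀) (t : ℝ) : ℝ :=
  Real.sqrt (∫ x in (0:ℝ)..π,
    ((ε t)^2 * (S.uxx x t)^2 + (S.ux x t)^2 + (S.u x t)^2 + (S.ut x t)^2))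


lemma sb_int {f : ℝ → ℝ} (hf : ContinuousOn f (Icc 0 π)) :
    IntervalIntegrable f volume 0 π :=
  ContinuousOn.intervalIntegrable (by rwa [uIcc_of_le Real.pi_pos.le])

lemma sb_ftc {f f' : ℝ → ℝ} {b : ℝ} (hb : b ∈ Icc (0:ℝ) π)
    (hf : ∀ x ∈ Icc (0:ℝ) π, HasDerivWithinAt f (f' x) (Icc 0 π) x)
    (hf' : ContinuousOn f' (Icc 0 π)) :
    ∫ x in (0:ℝ)..b, f' x = f b - f 0 := by
  have hsub : Icc (0:ℝ) b ⊆ Icc 0 π := Icc_subset_Icc le_rfl hb.2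
  apply intervalIntegral.integral_eq_sub_of_hasDerivAt_of_le hb.1
  · intro x hx
    exact ((hf x (hsub hx)).continuousWithinAt).mono hsub
  · intro x hx
    exact (hf x (hsub (Ioo_subset_Icc_self hx))).hasDerivAt
      (Icc_mem_nhds hx.1 (hx.2.trans_le hb.2))
  · exact ContinuousOn.intervalIntegrable (by rw [uIcc_of_le hb.1]; exact hf'.mono hsub)

lemma sb_lin {f g : ℝ → ℝ} {c : ℝ} (hf : ContinuousOn f (Icc 0 π)) (hg : ContinuousOn g (Icc 0 π)) :
    ∫ x in (0:ℝ)..π, (f x + c * g x) = (∫ x in (0:ℝ)..π, f x) + c * ∫ x in (0:ℝ)..π, g x := by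
  rw [intervalIntegral.integral_add (sb_int hf) ((sb_int hg).const_mul c),
    intervalIntegral.integral_const_mul]

lemma sb_mono {f g : ℝ → ℝ} (hf : ContinuousOn f (Icc 0 π)) (hg : ContinuousOn g (Icc 0 π))
    (h : ∀ x ∈ Ioo (0:ℝ) π, f x ≤ g x) :
    ∫ x in (0:ℝ)..π, f x ≤ ∫ x in (0:ℝ)..π, g x :=
  intervalIntegral.integral_mono_on_of_le_Ioo Real.pi_pos.le (sb_int hf) (sb_int hg) h

lemma sb_slice {f : ℝ → ℝ → ℝ} {t₀ t : ℝ}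
    (hf : ContinuousOn (Function.uncurry f) (Icc 0 π ×ˢ Ici t₀)) (ht : t₀ ≤ t) :
    ContinuousOn (fun x => f x t) (Icc 0 π) := by
  have : ContinuousOn (fun x : ℝ => (x, t)) (Icc 0 π) := by fun_prop
  exact hf.comp this (fun x hx => ⟨hx, ht⟩)

lemma sb_param_cont {f : ℝ → ℝ → ℝ} {t₀ : ℝ}
    (hf : ContinuousOn (Function.uncurry f) (Icc 0 π ×ˢ Ici t₀)) :
    ContinuousOn (fun t => ∫ x in (0:ℝ)..π, f x t) (Ici t₀) := by
  have hc : Continuous (Function.uncurry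
      (fun (t x : ℝ) => f (max 0 (min x π)) (max t t₀))) := by
    have h1 : Continuous (fun p : ℝ × ℝ => (max 0 (min p.2 π), max p.1 t₀)) := by fun_prop
    have := hf.comp_continuous h1 (fun p => ⟨⟨le_max_left _ _,
      max_le Real.pi_pos.le (min_le_right _ _)⟩, le_max_right p.1 t₀⟩)
    exact this
  have := intervalIntegral.continuous_parametric_intervalIntegral_of_continuous'
    (μ := volume) hc 0 π
  refine this.continuousOn.congr ?_
  intro t ht
  apply intervalIntegral.integral_congr
  intro x hx
  rw [uIcc_of_le Real.pi_pos.le] at hx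
  simp only
  rw [min_eq_left hx.2, max_eq_right hx.1, max_eq_left ht]

lemma sb_param_deriv {f f' : ℝ → ℝ → ℝ} {t₀ t b : ℝ} (hb : b ∈ Icc (0:ℝ) π)
    (hf : ContinuousOn (Function.uncurry f) (Icc 0 π ×ˢ Ici t₀))
    (hf' : ContinuousOn (Function.uncurry f') (Icc 0 π ×ˢ Ici t₀))
    (hd : ∀ x ∈ Icc (0:ℝ) π, ∀ t ∈ Ici t₀,
      HasDerivWithinAt (fun s => f x s) (f' x t) (Ici t₀) t) (ht : t₀ < t) :
    HasDerivAt (fun s => ∫ x in (0:ℝ)..b, f x s) (∫ x in (0:ℝ)..b, f' x t) t := by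
  have hcomp : IsCompact (Icc (0:ℝ) π ×ˢ Icc t₀ (t+1)) := isCompact_Icc.prod isCompact_Icc
  obtain ⟨M, hM⟩ := hcomp.exists_bound_of_continuousOn
    (hf'.mono (prod_mono le_rfl Icc_subset_Ici_self))
  have hsub : Icc (0:ℝ) b ⊆ Icc 0 π := Icc_subset_Icc le_rfl hb.2
  have hint : ∀ (g : ℝ → ℝ → ℝ), ContinuousOn (Function.uncurry g) (Icc 0 π ×ˢ Ici t₀) →
      ∀ s, t₀ ≤ s → IntervalIntegrable (fun x => g x s) volume 0 b := by
    intro g hg s hs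
    exact ContinuousOn.intervalIntegrable
      (by rw [uIcc_of_le hb.1]; exact (sb_slice hg hs).mono hsub)
  refine (intervalIntegral.hasDerivAt_integral_of_dominated_loc_of_deriv_le
    (F := fun s x => f x s) (F' := fun s x => f' x s) (bound := fun _ => M)
    (s := Ioo t₀ (t+1)) (Ioo_mem_nhds ht (by linarith)) ?_ ?_ ?_ ?_ ?_ ?_).2
  · filter_upwards [Ioi_mem_nhds ht] with s hs
    exact (hint f hf s (le_of_lt hs)).aestronglyMeasurable_restrict_uIoc
  · exact hint f hf t ht.le
  · exact (hint f' hf' t ht.le).aestronglyMeasurable_restrict_uIoc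
  · refine Eventually.of_forall fun x hx s hs => ?_
    rw [uIoc_of_le hb.1] at hx
    exact hM (x, s) ⟨hsub (Ioc_subset_Icc_self hx), Ioo_subset_Icc_self hs⟩
  · exact intervalIntegrable_const
  · refine Eventually.of_forall fun x hx s hs => ?_
    rw [uIoc_of_le hb.1] at hx
    exact (hd x (hsub (Ioc_subset_Icc_self hx)) s hs.1.le).hasDerivAt (Ici_mem_nhds hs.1)

/-- Sharp Poincare inequality on `[0,π]`. -/
lemma sb_poincare {u u' : ℝ → ℝ}
    (hu : ∀ x ∈ Icc (0:ℝ) π, HasDerivWithinAt u (u' x) (Icc 0 π) x)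
    (hu' : ContinuousOn u' (Icc 0 π)) (h0 : u 0 = 0) (hπ : u π = 0) :
    ∫ x in (0:ℝ)..π, (u x)^2 ≤ ∫ x in (0:ℝ)..π, (u' x)^2 := by
  have hcu : ContinuousOn u (Icc 0 π) := fun x hx => (hu x hx).continuousWithinAt
  have key : ∀ l ∈ Ioo (0:ℝ) 1, l^2 * ∫ x in (0:ℝ)..π, (u x)^2 ≤ ∫ x in (0:ℝ)..π, (u' x)^2 := by
    intro l hl
    have hcos : ∀ x ∈ Icc (0:ℝ) π, cos (l * (x - π/2)) ≠ 0 := by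
      intro x hx
      apply ne_of_gt
      have hp := Real.pi_pos
      apply Real.cos_pos_of_mem_Ioo
      constructor
      · nlinarith [hl.1, hl.2, hx.1, hx.2, mul_nonneg hl.1.le hx.1]
      · nlinarith [hl.1, hl.2, hx.1, hx.2, mul_nonneg hl.1.le (sub_nonneg.2 hx.2)]
    set φ : ℝ → ℝ := fun x => -l * tan (l * (x - π/2)) with hφ
    have hφd : ∀ x ∈ Icc (0:ℝ) π, HasDerivAt φ (-l^2 - (φ x)^2) x := by
      intro x hx
      have h1 : HasDerivAt (fun x : ℝ => l * (x - π/2)) (l * 1) x :=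
        ((hasDerivAt_id x).sub_const _).const_mul l
      have h2 := ((Real.hasDerivAt_tan (hcos x hx)).comp x h1).const_mul (-l)
      refine h2.congr_deriv ?_
      have := hcos x hx
      simp only [hφ, Real.tan_eq_sin_div_cos]
      generalize l * (x - π/2) = y at this ⊢
      field_simp
      nlinarith [Real.sin_sq_add_cos_sq y]
    have hcφ : ContinuousOn φ (Icc 0 π) := fun x hx =>
      (hφd x hx).continuousAt.continuousWithinAt
    have hft := sb_ftc (f := fun x => (u x)^2 * φ x)
      (f' := fun x => (u' x)^2 + (-l^2) * (u x)^2 + (-1) * (u' x - φ x * u x)^2)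
      (right_mem_Icc.2 Real.pi_pos.le)
      (by
        intro x hx
        have := ((hu x hx).pow 2).mul (hφd x hx).hasDerivWithinAt
        refine this.congr_deriv ?_
        simp
        ring) (by fun_prop)
    rw [sb_lin (by fun_prop) (by fun_prop), sb_lin (by fun_prop) (by fun_prop)] at hft
    simp only [h0, hπ] at hft
    have hpos : 0 ≤ ∫ x in (0:ℝ)..π, (u' x - φ x * u x)^2 :=
      intervalIntegral.integral_nonneg Real.pi_pos.le (fun x _ => sq_nonneg _)
    linarith
  have hlim : Tendsto (fun l : ℝ => l^2 * ∫ x in (0:ℝ)..π, (u x)^2) (nhdsWithin 1 (Iio 1))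
      (nhds (1^2 * ∫ x in (0:ℝ)..π, (u x)^2)) := by
    apply Tendsto.mono_left _ nhdsWithin_le_nhds
    exact (Continuous.tendsto (by fun_prop) 1)
  have := le_of_tendsto hlim (by
    filter_upwards [Ioo_mem_nhdsLT (show (0:ℝ) < 1 by norm_num)] with l hl
    exact key l hl)
  simpa using this

lemma sb_green {u u' u'' : ℝ → ℝ}
    (hu : ∀ x ∈ Icc (0:ℝ) π, HasDerivWithinAt u (u' x) (Icc 0 π) x)
    (hu' : ∀ x ∈ Icc (0:ℝ) π, HasDerivWithinAt u' (u'' x) (Icc 0 π) x)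
    (hc : ContinuousOn u'' (Icc 0 π)) (h0 : u 0 = 0) {b : ℝ} (hb : b ∈ Icc (0:ℝ) π) :
    ∫ x in (0:ℝ)..b, (b - x) * u'' x = u b - b * u' 0 := by
  have := sb_ftc (f := fun x => (b - x) * u' x + u x) (f' := fun x => (b - x) * u'' x) hb
    (by
      intro x hx
      have h := (((hasDerivWithinAt_id x (Icc 0 π)).const_sub b).mul (hu' x hx)).add (hu x hx)
      refine h.congr_deriv ?_
      simp) (by fun_prop)
  rw [this, h0]; ring

lemma sb_uxt {ε C F : ℝ → ℝ} {a' t₀ t : ℝ} (S : ClassicalSolution ε C F a' t₀) (ht : t₀ < t) :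
    ∃ uxt : ℝ → ℝ, (∀ x ∈ Icc (0:ℝ) π, HasDerivWithinAt (fun y => S.ut y t) (uxt x) (Icc 0 π) x) ∧
      (∀ x ∈ Icc (0:ℝ) π, HasDerivWithinAt uxt (S.uxxt x t) (Icc 0 π) x) := by
  set g : ℝ → ℝ := fun x => S.uxxt (max 0 (min x π)) t with hg
  have hgc : Continuous g := by
    have h1 : Continuous (fun x : ℝ => max 0 (min x π)) := by fun_prop
    exact (sb_slice S.cont_uxxt ht.le).comp_continuous h1
      (fun p => ⟨le_max_left _ _, max_le Real.pi_pos.le (min_le_right _ _)⟩)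
  have hgeq : ∀ x ∈ Icc (0:ℝ) π, g x = S.uxxt x t := by
    intro x hx
    simp only [hg]
    rw [min_eq_left hx.2, max_eq_right hx.1]
  set H : ℝ → ℝ := fun x => ∫ y in (0:ℝ)..x, (x - y) * g y with hH
  have hHd : ∀ x, HasDerivAt H (∫ y in (0:ℝ)..x, g y) x := by
    intro x
    have e : H = fun x => x * (∫ y in (0:ℝ)..x, g y) - ∫ y in (0:ℝ)..x, y * g y := by
      funext x
      simp only [hH]
      rw [← intervalIntegral.integral_const_mul, ← intervalIntegral.integral_sub
        (Continuous.intervalIntegrable (by fun_prop) _ _)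
        (Continuous.intervalIntegrable (by fun_prop) _ _)]
      congr 1
      funext y
      ring
    rw [e]
    have h1 := (hasDerivAt_id x).mul
      (intervalIntegral.integral_hasDerivAt_right (hgc.intervalIntegrable 0 x)
        hgc.stronglyMeasurable.stronglyMeasurableAtFilter hgc.continuousAt)
    have hgc2 : Continuous (fun y => y * g y) := by fun_prop
    have h2 := (intervalIntegral.integral_hasDerivAt_right (hgc2.intervalIntegrable 0 x)
        hgc2.stronglyMeasurable.stronglyMeasurableAtFilter hgc2.continuousAt)
    refine (h1.sub h2).congr_deriv ?_
    simp
  have hut : ∀ x ∈ Icc (0:ℝ) π, S.ut x t = H x - x / π * H π := by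
    have hG : ∀ b ∈ Icc (0:ℝ) π,
        HasDerivAt (fun s => ∫ y in (0:ℝ)..b, (b - y) * S.uxx y s) (H b) t := by
      intro b hb
      have h := sb_param_deriv (f := fun y s => (b - y) * S.uxx y s)
        (f' := fun y s => (b - y) * S.uxxt y s) (t₀ := t₀) (t := t) hb
        (by
          have : ContinuousOn (fun p : ℝ × ℝ => b - p.1) (Icc 0 π ×ˢ Ici t₀) := by fun_prop
          exact this.mul S.cont_uxx)
        (by
          have : ContinuousOn (fun p : ℝ × ℝ => b - p.1) (Icc 0 π ×ˢ Ici t₀) := by fun_prop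
          exact this.mul S.cont_uxxt)
        (fun x hx s hs => (S.huxxt x hx s hs).const_mul _) ht
      refine h.congr_deriv ?_
      apply intervalIntegral.integral_congr
      intro y hy
      rw [uIcc_of_le hb.1] at hy
      simp only
      rw [hgeq y ⟨hy.1, hy.2.trans hb.2⟩]
    have hgr : ∀ s, t₀ ≤ s → ∀ b ∈ Icc (0:ℝ) π,
        ∫ y in (0:ℝ)..b, (b - y) * S.uxx y s = S.u b s - b * S.ux 0 s := fun s hs b hb =>
      sb_green (S.hux s hs) (S.huxx s hs) (sb_slice S.cont_uxx hs) (S.bc0 s hs) hb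
    intro x hx
    have h1 := (hG x hx).sub ((hG π (right_mem_Icc.2 Real.pi_pos.le)).const_mul (x / π))
    have h2 : HasDerivAt (fun s => S.u x s) (S.ut x t) t :=
      (S.hut x hx t ht.le).hasDerivAt (Ici_mem_nhds ht)
    refine h2.unique (h1.congr_of_eventuallyEq ?_)
    filter_upwards [Ioi_mem_nhds ht] with s hs
    simp only [Pi.sub_apply]
    rw [hgr s (le_of_lt hs) x hx, hgr s (le_of_lt hs) π (right_mem_Icc.2 Real.pi_pos.le),
      S.bcπ s (mem_Ici.2 (le_of_lt hs))]
    have := Real.pi_pos.ne'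
    field_simp
    ring
  refine ⟨fun x => (∫ y in (0:ℝ)..x, g y) - 1 / π * H π, ?_, ?_⟩
  · intro x hx
    have h1 : HasDerivAt (fun x => H x - x / π * H π) ((∫ y in (0:ℝ)..x, g y) - 1 / π * H π) x :=
      (hHd x).sub (((hasDerivAt_id x).div_const π).mul_const _)
    exact h1.hasDerivWithinAt.congr (fun y hy => hut y hy) (hut x hx)
  · intro x hx
    have h := (intervalIntegral.integral_hasDerivAt_right (hgc.intervalIntegrable 0 x)
        hgc.stronglyMeasurable.stronglyMeasurableAtFilter hgc.continuousAt).sub_const (1 / π * H π)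
    rw [hgeq x hx] at h
    exact h.hasDerivWithinAt

lemma sb_F_sign {F F' : ℝ → ℝ} {k : ℝ} (hFderiv : ∀ z, HasDerivAt F (F' z) z) (hF0 : F 0 = 0)
    (hFk : ∀ z, F' z ≤ k) : (∀ z, 0 ≤ z → F z ≤ k * z) ∧ (∀ z, z ≤ 0 → k * z ≤ F z) := by
  have hd : ∀ z, HasDerivAt (fun z => F z - k * z) (F' z - k * 1) z := fun z =>
    (hFderiv z).sub ((hasDerivAt_id z).const_mul k)
  have hanti : Antitone (fun z => F z - k * z) := by
    apply antitone_of_deriv_nonpos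
    · exact fun z => (hd z).differentiableAt
    · intro z
      rw [(hd z).deriv]
      linarith [hFk z]
  constructor
  · intro z hz
    have := hanti hz
    simp only [hF0] at this
    linarith
  · intro z hz
    have := hanti hz
    simp only [hF0] at this
    linarith

lemma sb_Phi {F : ℝ → ℝ} {k : ℝ} (hFc : Continuous F)
    (h : (∀ z, 0 ≤ z → F z ≤ k * z) ∧ (∀ z, z ≤ 0 → k * z ≤ F z)) (z : ℝ) :
    ∫ s in (0:ℝ)..z, F s ≤ k / 2 * z^2 := by
  have hi : ∀ a b : ℝ, ∫ s in a..b, k * s = k / 2 * (b^2 - a^2) := by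
    intro a b
    rw [intervalIntegral.integral_const_mul, integral_id]; ring
  rcases le_total 0 z with hz | hz
  · have := intervalIntegral.integral_mono_on (μ := volume) hz (hFc.intervalIntegrable 0 z)
      (Continuous.intervalIntegrable (u := fun s => k * s) (by fun_prop) 0 z)
      (fun x hx => h.1 x hx.1)
    rw [hi] at this
    linarith
  · have := intervalIntegral.integral_mono_on (μ := volume) hz
      (Continuous.intervalIntegrable (u := fun s => k * s) (by fun_prop) z 0)
      (hFc.intervalIntegrable z 0) (fun x hx => h.2 x hx.2)
    rw [hi] at this
    rw [intervalIntegral.integral_symm]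
    linarith

/-- Elementary integral facts for a function with Dirichlet conditions. -/
lemma sb_basic {u u' u'' : ℝ → ℝ}
    (hu : ∀ x ∈ Icc (0:ℝ) π, HasDerivWithinAt u (u' x) (Icc 0 π) x)
    (hu' : ∀ x ∈ Icc (0:ℝ) π, HasDerivWithinAt u' (u'' x) (Icc 0 π) x)
    (hc : ContinuousOn u'' (Icc 0 π)) (h0 : u 0 = 0) (hπ : u π = 0) :
    ∫ x in (0:ℝ)..π, u x * u'' x = -∫ x in (0:ℝ)..π, (u' x)^2 := by
  have hcu : ContinuousOn u (Icc 0 π) := fun x hx => (hu x hx).continuousWithinAt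
  have hcu' : ContinuousOn u' (Icc 0 π) := fun x hx => (hu' x hx).continuousWithinAt
  have := sb_ftc (f := fun x => u x * u' x) (f' := fun x => u x * u'' x + 1 * (u' x)^2)
      (right_mem_Icc.2 Real.pi_pos.le)
      (by
        intro x hx
        refine ((hu x hx).mul (hu' x hx)).congr_deriv ?_
        ring) (by fun_prop)
  rw [sb_lin (by fun_prop) (by fun_prop)] at this
  simp only [h0, hπ] at this
  linarith

lemma sb_algebra {e e1 e2 c c1 γ θ μ k A a' X P U T R Cbar ebar ν : ℝ}
    (he : 0 ≤ e) (hμ : 0 < μ) (hk : 0 ≤ k) (ha' : 0 ≤ a') (hCbar : 0 < Cbar)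
    (hcC : Cbar ≤ c) (hdiss : μ * (1 + e) ≤ c - e1) (he2 : ebar ≤ e2)
    (hmuk : 0 < μ + Cbar / 2 - 2 * k) (hν : ν ≤ e + a') (hγ0 : 0 ≤ γ)
    (hγ : A^2 / (4*μ) + θ + θ^2 * A^2 / 4 ≤ γ * ν)
    (hθa : a' ≤ θ) (hθk : 2 * k ≤ θ * μ)
    (hθ : 3/2 - ebar / 2 + a' * Cbar / 2 ≤ θ * Cbar / 4)
    (hc1 : (1 + γ) * c1 ≤ 1)
    (hU : U ≤ P) (hP0 : 0 ≤ P) (hT : 0 ≤ T) (hPX : P ≤ X) (hR : R ≤ k * P) {Q : ℝ} (hQ : T ≤ Q) :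
    - (γ * e) * Q + (-e * (c - e1) + μ * e^2) * X + e * R
      + (A^2 / (4*μ) + θ + θ^2 * A^2 / 4 - (1+γ) * a') * T + (1 + θ * k) * U - θ * c * P
      + 1/2 * ((1+γ) * c1 - e2 + (a' + θ) * e1) * P ≤ 0 := by
  have hθ0 : 0 ≤ θ := ha'.trans hθa
  have hX : 0 ≤ X := hP0.trans hPX
  have s1 : γ * e * T ≤ γ * e * Q := by gcongr
  have s2 : e * (μ * (1 + e)) * X ≤ e * (c - e1) * X := by gcongr
  have s2' : 0 ≤ e * μ * X := by positivity
  have s3 : e * R ≤ e * (k * P) := by gcongr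
  have s4 : (A^2 / (4*μ) + θ + θ^2 * A^2 / 4) * T ≤ γ * (e + a') * T := by
    have : γ * ν ≤ γ * (e + a') := by gcongr
    exact mul_le_mul_of_nonneg_right (hγ.trans this) hT
  have s4' : 0 ≤ a' * T := by positivity
  have s5 : (1 + θ * k) * U ≤ (1 + θ * k) * P := by gcongr
  have s6 : e * k + 1 + θ * k - θ * c + 1/2 * ((1+γ) * c1 - e2 + (a' + θ) * e1) ≤ 0 := by
    have h1 : (a' + θ) * e1 ≤ (a' + θ) * (c - μ * (1 + e)) := by
      apply mul_le_mul_of_nonneg_left _ (by positivity); linarith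
    have h2 : (θ - a') * Cbar ≤ (θ - a') * c :=
      mul_le_mul_of_nonneg_left hcC (by linarith)
    have h3 : 0 ≤ θ * (μ + Cbar / 2 - 2 * k) := by positivity
    have h4 : e * (2 * k) ≤ e * (θ * μ) := by gcongr
    have h5 : 0 ≤ a' * μ := by positivity
    have h6 : 0 ≤ a' * μ * e := by positivity
    nlinarith
  have s7 := mul_le_mul_of_nonneg_right s6 hP0
  nlinarith

set_option maxHeartbeats 2000000 in
lemma sb_static {F F' u ux uxx ut uxt utt uxxt aa : ℝ → ℝ}
    {e e1 e2 c c1 γ θ μ k A a' Cbar ebar ν : ℝ}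
    (hu : ∀ x ∈ Icc (0:ℝ) π, HasDerivWithinAt u (ux x) (Icc 0 π) x)
    (hux : ∀ x ∈ Icc (0:ℝ) π, HasDerivWithinAt ux (uxx x) (Icc 0 π) x)
    (hut : ∀ x ∈ Icc (0:ℝ) π, HasDerivWithinAt ut (uxt x) (Icc 0 π) x)
    (huxt : ∀ x ∈ Icc (0:ℝ) π, HasDerivWithinAt uxt (uxxt x) (Icc 0 π) x)
    (cuxx : ContinuousOn uxx (Icc 0 π)) (cuxxt : ContinuousOn uxxt (Icc 0 π))
    (cutt : ContinuousOn utt (Icc 0 π))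
    (u0 : u 0 = 0) (uπ : u π = 0) (ut0 : ut 0 = 0) (utπ : ut π = 0)
    (haa0 : ∀ x ∈ Icc (0:ℝ) π, 0 ≤ aa x) (haaA : ∀ x ∈ Icc (0:ℝ) π, aa x ≤ A)
    (pde : ∀ x ∈ Ioo (0:ℝ) π,
      -e * uxxt x + utt x - c * uxx x + a' * ut x = F (u x) - aa x * ut x)
    (hFderiv : ∀ z, HasDerivAt F (F' z) z) (hF'cont : Continuous F') (hF0 : F 0 = 0)
    (hFk : ∀ z, F' z ≤ k)
    (he : 0 ≤ e) (hμ : 0 < μ) (hk : 0 ≤ k) (ha' : 0 ≤ a') (hCbar : 0 < Cbar)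
    (hcC : Cbar ≤ c) (hdiss : μ * (1 + e) ≤ c - e1) (he2 : ebar ≤ e2)
    (hmuk : 0 < μ + Cbar / 2 - 2 * k) (hν : ν ≤ e + a') (hγ0 : 0 ≤ γ)
    (hγ : A^2 / (4*μ) + θ + θ^2 * A^2 / 4 ≤ γ * ν)
    (hθa : a' ≤ θ) (hθk : 2 * k ≤ θ * μ)
    (hθ : 3/2 - ebar / 2 + a' * Cbar / 2 ≤ θ * Cbar / 4)
    (hc1 : (1 + γ) * c1 ≤ 1) :
    ∫ x in (0:ℝ)..π, ((ut x - e * uxx x) * (utt x - (e1 * uxx x + e * uxxt x))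
      + γ * (ut x * utt x) + θ * (ut x * ut x + u x * utt x) + θ * a' * (u x * ut x)
      - (1 + γ) * (F (u x) * ut x)
      - 1/2 * (((1+γ) * c1 - e2 + (a' + θ) * e1) * (u x * uxx x)
        + ((1+γ) * c - e1 + (a' + θ) * e) * (ut x * uxx x + u x * uxxt x))) ≤ 0 := by
  have hFc : Continuous F := continuous_iff_continuousAt.2 fun z => (hFderiv z).continuousAt
  have cu : ContinuousOn u (Icc 0 π) := fun x hx => (hu x hx).continuousWithinAt
  have cux : ContinuousOn ux (Icc 0 π) := fun x hx => (hux x hx).continuousWithinAt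
  have cut : ContinuousOn ut (Icc 0 π) := fun x hx => (hut x hx).continuousWithinAt
  have cuxt : ContinuousOn uxt (Icc 0 π) := fun x hx => (huxt x hx).continuousWithinAt
  have cF : ContinuousOn (fun x => F (u x)) (Icc 0 π) := hFc.comp_continuousOn cu
  have cF' : ContinuousOn (fun x => F' (u x)) (Icc 0 π) := hF'cont.comp_continuousOn cu
  have hsgn := sb_F_sign hFderiv hF0 hFk
  have hθ0 : 0 ≤ θ := ha'.trans hθa
  have hπm : π ∈ Icc (0:ℝ) π := right_mem_Icc.2 Real.pi_pos.le
  -- integral facts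
  have hP := sb_basic hu hux cuxx u0 uπ
  have hQ := sb_basic hut huxt cuxxt ut0 utπ
  have hUP := sb_poincare hu cux u0 uπ
  have hTQ := sb_poincare hut cuxt ut0 utπ
  have hPX : ∫ x in (0:ℝ)..π, (ux x)^2 ≤ ∫ x in (0:ℝ)..π, (uxx x)^2 := by
    have h1 := sb_mono (f := fun _ => (0:ℝ))
      (g := fun x => (u x)^2 + 2 * (u x * uxx x) + 1 * (uxx x)^2) (by fun_prop) (by fun_prop)
      (fun x _ => by nlinarith [sq_nonneg (u x + uxx x)])
    rw [sb_lin (by fun_prop) (by fun_prop), sb_lin (by fun_prop) (by fun_prop)] at h1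
    simp only [intervalIntegral.integral_zero] at h1
    linarith
  have hJ : ∫ x in (0:ℝ)..π, ut x * uxx x = ∫ x in (0:ℝ)..π, u x * uxxt x := by
    have := sb_ftc (f := fun x => ux x * ut x - u x * uxt x)
      (f' := fun x => ut x * uxx x + (-1) * (u x * uxxt x)) hπm
      (by
        intro x hx
        refine (((hux x hx).mul (hut x hx)).sub ((hu x hx).mul (huxt x hx))).congr_deriv ?_
        ring) (by fun_prop)
    rw [sb_lin (by fun_prop) (by fun_prop)] at this
    simp only [u0, uπ, ut0, utπ] at this
    linarith
  have hR : -∫ x in (0:ℝ)..π, F (u x) * uxx x ≤ k * ∫ x in (0:ℝ)..π, (ux x)^2 := by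
    have h1 := sb_ftc (f := fun x => F (u x) * ux x)
      (f' := fun x => F (u x) * uxx x + 1 * (F' (u x) * (ux x)^2)) hπm
      (by
        intro x hx
        refine (((hFderiv (u x)).comp_hasDerivWithinAt x (hu x hx)).mul (hux x hx)).congr_deriv ?_
        simp only [Function.comp]
        ring) (by fun_prop)
    rw [sb_lin (by fun_prop) (by fun_prop)] at h1
    simp only [u0, uπ, hF0] at h1
    have h2 := sb_mono (f := fun x => F' (u x) * (ux x)^2) (g := fun x => k * (ux x)^2)
      (by fun_prop) (by fun_prop)
      (fun x _ => mul_le_mul_of_nonneg_right (hFk _) (sq_nonneg _))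
    rw [intervalIntegral.integral_const_mul] at h2
    linarith
  have hP0 : 0 ≤ ∫ x in (0:ℝ)..π, (ux x)^2 :=
    intervalIntegral.integral_nonneg Real.pi_pos.le (fun x _ => sq_nonneg _)
  have hT0 : 0 ≤ ∫ x in (0:ℝ)..π, (ut x)^2 :=
    intervalIntegral.integral_nonneg Real.pi_pos.le (fun x _ => sq_nonneg _)
  have hfin := sb_algebra he hμ hk ha' hCbar hcC hdiss he2 hmuk hν hγ0 hγ hθa hθk hθ hc1
    hUP hP0 hT0 hPX hR hTQ
  set K := (1+γ) * c - e1 + (a' + θ) * e with hK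
  set K1 := (1+γ) * c1 - e2 + (a' + θ) * e1 with hK1
  refine le_trans (sb_mono (g := fun x => 0 + γ * e * (ut x * uxxt x)
    + (-e * (c - e1) + μ * e^2) * (uxx x)^2 + (-e) * (F (u x) * uxx x)
    + (A^2 / (4*μ) + θ + θ^2 * A^2 / 4 - (1+γ) * a') * (ut x)^2 + (1 + θ * k) * (u x)^2
    + (θ * c - 1/2 * K1) * (u x * uxx x)
    + (1/2 * K - θ * e) * (ut x * uxx x) + (θ * e - 1/2 * K) * (u x * uxxt x))
    (by fun_prop) (by fun_prop) ?_) ?_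
  · intro x hx
    have hx' := Ioo_subset_Icc_self hx
    have hp : utt x = e * uxxt x + c * uxx x - (a' + aa x) * ut x + F (u x) := by
      linarith only [pde x hx]
    have h0 := haa0 x hx'
    have h1 := haaA x hx'
    have hA2 : (aa x)^2 ≤ A^2 := by gcongr
    have huF : u x * F (u x) ≤ k * (u x)^2 := by
      rcases le_total 0 (u x) with h | h
      · have := mul_le_mul_of_nonneg_left (hsgn.1 _ h) h
        linarith only [this]
      · have := mul_le_mul_of_nonpos_left (hsgn.2 _ h) h
        linarith only [this]
    have q1 : θ * (u x * F (u x)) ≤ θ * (k * (u x)^2) := by gcongr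
    have q2 : e * aa x * uxx x * ut x ≤ μ * e^2 * (uxx x)^2 + A^2 / (4*μ) * (ut x)^2 := by
      have hh : e * aa x * uxx x * ut x
          ≤ μ * e^2 * (uxx x)^2 + (aa x)^2 / (4*μ) * (ut x)^2 := by
        have : 0 ≤ μ * (e * uxx x - aa x * ut x / (2*μ))^2 := by positivity
        have e3 : μ * (e * uxx x - aa x * ut x / (2*μ))^2
          = μ * e^2 * (uxx x)^2 - e * aa x * uxx x * ut x + (aa x)^2 / (4*μ) * (ut x)^2 := by
          field_simp; ring
        linarith
      have : (aa x)^2 / (4*μ) * (ut x)^2 ≤ A^2 / (4*μ) * (ut x)^2 := by gcongr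
      linarith
    have q3 : -(θ * aa x * (u x * ut x)) ≤ (u x)^2 + θ^2 * A^2 / 4 * (ut x)^2 := by
      have : θ^2 * (aa x)^2 / 4 * (ut x)^2 ≤ θ^2 * A^2 / 4 * (ut x)^2 := by gcongr
      have := sq_nonneg (u x + θ * aa x * ut x / 2)
      linarith
    have q4 : 0 ≤ (1 + γ) * aa x * (ut x)^2 := by positivity
    rw [hp, hK]
    linear_combination q1 + q2 + q3 + q4
  · rw [sb_lin (by fun_prop) (by fun_prop), sb_lin (by fun_prop) (by fun_prop),
      sb_lin (by fun_prop) (by fun_prop), sb_lin (by fun_prop) (by fun_prop),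
      sb_lin (by fun_prop) (by fun_prop), sb_lin (by fun_prop) (by fun_prop),
      sb_lin (by fun_prop) (by fun_prop), sb_lin (by fun_prop) (by fun_prop),
      hP, hQ, hJ, intervalIntegral.integral_zero]
    linarith

set_option maxHeartbeats 2000000 in
lemma sb_lower {F Φ u ux uxx ut : ℝ → ℝ} {e e1 c γ θ μ k a' Cbar : ℝ}
    (hu : ∀ x ∈ Icc (0:ℝ) π, HasDerivWithinAt u (ux x) (Icc 0 π) x)
    (hux : ∀ x ∈ Icc (0:ℝ) π, HasDerivWithinAt ux (uxx x) (Icc 0 π) x)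
    (cuxx : ContinuousOn uxx (Icc 0 π)) (cut : ContinuousOn ut (Icc 0 π))
    (u0 : u 0 = 0) (uπ : u π = 0)
    (hΦc : Continuous Φ) (hΦ : ∀ z, Φ z ≤ k / 2 * z^2)
    (he : 0 ≤ e) (hk : 0 ≤ k) (ha' : 0 ≤ a') (hCbar : 0 < Cbar) (hCk : k ≤ Cbar) (hμ : 0 < μ)
    (hcC : Cbar ≤ c) (hdiss : μ * (1 + e) ≤ c - e1)
    (hmuk : 0 < μ + Cbar / 2 - 2 * k) (hθ0 : 0 ≤ θ)
    (hγ : 4 * θ^2 / Cbar + 2 ≤ γ) :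
    ∫ x in (0:ℝ)..π, (e^2 * (uxx x)^2 + (ux x)^2 + (u x)^2 + (ut x)^2) ≤
    (4 + 16 / Cbar) * ∫ x in (0:ℝ)..π, (1/2 * (ut x - e * uxx x)^2 + γ / 2 * (ut x)^2
      + θ * (u x * ut x) + θ * a' / 2 * (u x)^2 - (1 + γ) * Φ (u x)
      - 1/2 * (((1+γ) * c - e1 + (a' + θ) * e) * (u x * uxx x))) := by
  have cu : ContinuousOn u (Icc 0 π) := fun x hx => (hu x hx).continuousWithinAt
  have cux : ContinuousOn ux (Icc 0 π) := fun x hx => (hux x hx).continuousWithinAt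
  have cΦ : ContinuousOn (fun x => Φ (u x)) (Icc 0 π) := hΦc.comp_continuousOn cu
  have hP := sb_basic hu hux cuxx u0 uπ
  have hUP := sb_poincare hu cux u0 uπ
  have hP0 : 0 ≤ ∫ x in (0:ℝ)..π, (ux x)^2 :=
    intervalIntegral.integral_nonneg Real.pi_pos.le (fun x _ => sq_nonneg _)
  have hT0 : 0 ≤ ∫ x in (0:ℝ)..π, (ut x)^2 :=
    intervalIntegral.integral_nonneg Real.pi_pos.le (fun x _ => sq_nonneg _)
  have hW0 : 0 ≤ ∫ x in (0:ℝ)..π, (ut x - e * uxx x)^2 :=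
    intervalIntegral.integral_nonneg Real.pi_pos.le (fun x _ => sq_nonneg _)
  set K := (1+γ) * c - e1 + (a' + θ) * e with hK
  have hθC : 0 ≤ 4 * θ^2 / Cbar := by positivity
  have hγ1 : 1 ≤ γ := by linarith
  have h1 := sb_mono (f := fun x => 0 + 1/2 * (ut x - e * uxx x)^2
      + (γ / 2 - 2 * θ^2 / Cbar) * (ut x)^2 + (-(Cbar / 8) - (1 + γ) * k / 2) * (u x)^2
      + (- (1/2) * K) * (u x * uxx x))
    (g := fun x => 1/2 * (ut x - e * uxx x)^2 + γ / 2 * (ut x)^2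
      + θ * (u x * ut x) + θ * a' / 2 * (u x)^2 - (1 + γ) * Φ (u x)
      - 1/2 * (K * (u x * uxx x))) (by fun_prop) (by fun_prop)
    (by
      intro x _
      have q1 : (1 + γ) * Φ (u x) ≤ (1 + γ) * (k / 2 * (u x)^2) :=
        mul_le_mul_of_nonneg_left (hΦ _) (by linarith)
      have q2 : 0 ≤ θ * a' / 2 * (u x)^2 := by positivity
      have q3 : 0 ≤ Cbar / 8 * (u x)^2 + θ * (u x * ut x) + 2 * θ^2 / Cbar * (ut x)^2 := by
        have e3 : Cbar / 8 * (u x)^2 + θ * (u x * ut x) + 2 * θ^2 / Cbar * (ut x)^2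
          = Cbar / 8 * (u x + 4 * θ / Cbar * ut x)^2 := by field_simp; ring
        rw [e3]; positivity
      linarith only [q1, q2, q3])
  rw [sb_lin (by fun_prop) (by fun_prop), sb_lin (by fun_prop) (by fun_prop),
      sb_lin (by fun_prop) (by fun_prop), sb_lin (by fun_prop) (by fun_prop), hP,
      intervalIntegral.integral_zero] at h1
  have h2 := sb_mono (f := fun x => e^2 * (uxx x)^2 + (ux x)^2 + (u x)^2 + (ut x)^2)
    (g := fun x => 0 + 2 * (ut x - e * uxx x)^2 + 3 * (ut x)^2 + 1 * (ux x)^2 + 1 * (u x)^2)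
    (by fun_prop) (by fun_prop)
    (by
      intro x _
      have := sq_nonneg (2 * ut x - e * uxx x)
      linarith only [this])
  rw [sb_lin (by fun_prop) (by fun_prop), sb_lin (by fun_prop) (by fun_prop),
      sb_lin (by fun_prop) (by fun_prop), sb_lin (by fun_prop) (by fun_prop),
      intervalIntegral.integral_zero] at h2
  generalize (∫ x in (0:ℝ)..π, (1/2 * (ut x - e * uxx x)^2 + γ / 2 * (ut x)^2
      + θ * (u x * ut x) + θ * a' / 2 * (u x)^2 - (1 + γ) * Φ (u x)
      - 1/2 * (K * (u x * uxx x)))) = V at h1 ⊢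
  generalize (∫ x in (0:ℝ)..π, (ut x - e * uxx x)^2) = W at *
  generalize (∫ x in (0:ℝ)..π, (ux x)^2) = P at *
  generalize (∫ x in (0:ℝ)..π, (ut x)^2) = T at *
  generalize (∫ x in (0:ℝ)..π, (u x)^2) = U at *
  have hKl : γ * Cbar + μ ≤ K := by
    have a1 : γ * Cbar ≤ γ * c := by gcongr
    have a2 : 0 ≤ (a' + θ) * e := by positivity
    have a3 : 0 ≤ μ * e := by positivity
    rw [hK]; linarith only [a1, a2, a3, hdiss]
  have hb : 1/2 * W + T + Cbar / 8 * P ≤ V := by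
    have b1 : (γ * Cbar + μ) * P ≤ K * P := by gcongr
    have b2 : (Cbar / 8 + (1 + γ) * k / 2) * U ≤ (Cbar / 8 + (1 + γ) * k / 2) * P := by gcongr
    have b3 : 1 * T ≤ (γ / 2 - 2 * θ^2 / Cbar) * T := by
      apply mul_le_mul_of_nonneg_right _ hT0
      have : 4 * θ^2 / Cbar = 2 * (2 * θ^2 / Cbar) := by ring
      linarith
    have b4 : 0 ≤ (γ - 1) * (Cbar - k) * P := by
      have := sub_nonneg.2 hγ1; have := sub_nonneg.2 hCk; positivity
    have b5 : 0 ≤ (μ + Cbar / 2 - 2 * k) * P := by positivity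
    linarith only [h1, b1, b2, b3, b4, b5]
  have hb2 : 16 / Cbar * (Cbar / 8 * P) ≤ 16 / Cbar * V := by
    apply mul_le_mul_of_nonneg_left _ (by positivity); linarith
  have hb3 : 16 / Cbar * (Cbar / 8 * P) = 2 * P := by field_simp; ring
  have hc8 : 0 ≤ Cbar / 8 * P := by positivity
  linarith

set_option maxHeartbeats 2000000 in
lemma sb_upper {Φ u ux uxx ut : ℝ → ℝ} {e K γ θ a' δ L : ℝ}
    (hu : ∀ x ∈ Icc (0:ℝ) π, HasDerivWithinAt u (ux x) (Icc 0 π) x)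
    (hux : ∀ x ∈ Icc (0:ℝ) π, HasDerivWithinAt ux (uxx x) (Icc 0 π) x)
    (cuxx : ContinuousOn uxx (Icc 0 π)) (cut : ContinuousOn ut (Icc 0 π))
    (u0 : u 0 = 0) (uπ : u π = 0)
    (hΦc : Continuous Φ) (hL : ∀ z, |z| ≤ (π + δ^2) / 2 → |Φ z| ≤ L)
    (ha' : 0 ≤ a') (hθ0 : 0 ≤ θ) (hγ : 0 ≤ γ)
    (hd : ∫ x in (0:ℝ)..π, (e^2 * (uxx x)^2 + (ux x)^2 + (u x)^2 + (ut x)^2) ≤ δ^2) :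
    ∫ x in (0:ℝ)..π, (1/2 * (ut x - e * uxx x)^2 + γ / 2 * (ut x)^2
      + θ * (u x * ut x) + θ * a' / 2 * (u x)^2 - (1 + γ) * Φ (u x)
      - 1/2 * (K * (u x * uxx x))) ≤
    (1 + γ / 2 + θ / 2 + θ * a' / 2 + |K| / 2) * δ^2 + (1 + γ) * L * π := by
  have cu : ContinuousOn u (Icc 0 π) := fun x hx => (hu x hx).continuousWithinAt
  have cux : ContinuousOn ux (Icc 0 π) := fun x hx => (hux x hx).continuousWithinAt
  have cΦ : ContinuousOn (fun x => Φ (u x)) (Icc 0 π) := hΦc.comp_continuousOn cu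
  have hP := sb_basic hu hux cuxx u0 uπ
  have hP0 : 0 ≤ ∫ x in (0:ℝ)..π, (ux x)^2 :=
    intervalIntegral.integral_nonneg Real.pi_pos.le (fun x _ => sq_nonneg _)
  have hPD : ∫ x in (0:ℝ)..π, (ux x)^2 ≤ δ^2 := by
    refine le_trans (sb_mono (by fun_prop) (by fun_prop) ?_) hd
    intro x _
    have : 0 ≤ e^2 * (uxx x)^2 + (u x)^2 + (ut x)^2 := by positivity
    linarith only [this]
  have hsup : ∀ x ∈ Icc (0:ℝ) π, |u x| ≤ (π + δ^2) / 2 := by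
    intro x hx
    have h1 := sb_ftc hx hu cux
    rw [u0, sub_zero] at h1
    have hci : ContinuousOn (fun y => 1/2 + 1/2 * (ux y)^2) (Icc 0 π) := by fun_prop
    have h2 := intervalIntegral.norm_integral_le_of_norm_le (f := ux)
      (g := fun y => 1/2 + 1/2 * (ux y)^2) (μ := volume) hx.1
      (Eventually.of_forall (fun y _ => by
        rw [Real.norm_eq_abs, abs_le]
        constructor
        · nlinarith only [sq_nonneg (ux y + 1)]
        · nlinarith only [sq_nonneg (ux y - 1)]))
      (ContinuousOn.intervalIntegrable (by
        rw [uIcc_of_le hx.1]; exact hci.mono (Icc_subset_Icc le_rfl hx.2)))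
    have h3 : ∫ y in (0:ℝ)..x, (1/2 + 1/2 * (ux y)^2) ≤ ∫ y in (0:ℝ)..π, (1/2 + 1/2 * (ux y)^2) :=
      intervalIntegral.integral_mono_interval le_rfl hx.1 hx.2
        (Eventually.of_forall (fun y => by
          have := sq_nonneg (ux y)
          simp only [Pi.zero_apply]; linarith)) (sb_int hci)
    rw [sb_lin (by fun_prop) (by fun_prop), intervalIntegral.integral_const, smul_eq_mul] at h3
    rw [h1, Real.norm_eq_abs] at h2
    linarith
  have h1 := sb_mono (g := fun x => (1 + γ) * L
      + (1 + γ / 2 + θ / 2 + θ * a' / 2) * (e^2 * (uxx x)^2 + (ux x)^2 + (u x)^2 + (ut x)^2)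
      + (- (1/2) * K) * (u x * uxx x))
    (f := fun x => 1/2 * (ut x - e * uxx x)^2 + γ / 2 * (ut x)^2
      + θ * (u x * ut x) + θ * a' / 2 * (u x)^2 - (1 + γ) * Φ (u x)
      - 1/2 * (K * (u x * uxx x))) (by fun_prop) (by fun_prop)
    (by
      intro x hx
      have q0 := abs_le.1 (hL (u x) (hsup x (Ioo_subset_Icc_self hx)))
      have q1 : (1 + γ) * (-L) ≤ (1 + γ) * Φ (u x) :=
        mul_le_mul_of_nonneg_left q0.1 (by linarith)
      have q2 : 0 ≤ θ / 2 * (u x - ut x)^2 := by positivity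
      have q3 : 0 ≤ 1/2 * (ut x + e * uxx x)^2 := by positivity
      have q4 : 0 ≤ (1 + γ / 2 + θ / 2 + θ * a' / 2) * (ux x)^2 := by positivity
      have q5 : 0 ≤ (1 + γ / 2) * (u x)^2 := by positivity
      have q6 : 0 ≤ θ * a' / 2 * (ut x)^2 := by positivity
      have q7 : 0 ≤ (γ / 2 + θ / 2 + θ * a' / 2) * (e^2 * (uxx x)^2) := by positivity
      linarith only [q1, q2, q3, q4, q5, q6, q7])
  rw [sb_lin (by fun_prop) (by fun_prop), sb_lin (by fun_prop) (by fun_prop), hP,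
      intervalIntegral.integral_const, smul_eq_mul] at h1
  refine h1.trans ?_
  have r1 := mul_le_mul_of_nonneg_left hd
    (show 0 ≤ (1 + γ / 2 + θ / 2 + θ * a' / 2) by positivity)
  have r2 := mul_le_mul_of_nonneg_right (le_abs_self K) hP0
  have r3 := mul_le_mul_of_nonneg_left hPD (abs_nonneg K)
  linarith only [r1, r2, r3]
/-- Theorem 4.2, part 1 (boundedness): with `ρ = ∞`, `τ = 0` (so `a ≤ A`),
`∫₀^∞ dt/g(t) = ∞`, and `C' ≤ 0` or `C'(t) → 0`, the solutions are bounded. -/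
theorem solutions_bounded
    (ε ε' ε'' C C' F F' : ℝ → ℝ) (a' A k μ Cbar εbar ebar : ℝ)
    (hεderiv : ∀ t ∈ Ici (0:ℝ), HasDerivWithinAt ε (ε' t) (Ici 0) t)
    (hε'deriv : ∀ t ∈ Ici (0:ℝ), HasDerivWithinAt ε' (ε'' t) (Ici 0) t)
    (hε''cont : ContinuousOn ε'' (Ici 0))
    (hεnonneg : ∀ t ∈ Ici (0:ℝ), 0 ≤ ε t)
    (hCderiv : ∀ t ∈ Ici (0:ℝ), HasDerivWithinAt C (C' t) (Ici 0) t)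
    (hC'cont : ContinuousOn C' (Ici 0))
    (hFderiv : ∀ z, HasDerivAt F (F' z) z)
    (hF'cont : Continuous F')
    (hF0 : F 0 = 0)
    (hCbar : IsGLB (C '' Ioi (0:ℝ)) Cbar) (hCbarpos : 0 < Cbar)
    (hεbar : IsGLB (ε '' Ioi (0:ℝ)) εbar)
    (hebar : IsGLB (ε'' '' Ioi (0:ℝ)) ebar)
    (hA : 0 ≤ A) (hk : 0 ≤ k) (hμ : 0 < μ)
    (hFk : ∀ z, F' z ≤ k)
    (hCk : k ≤ Cbar)
    (hdiss : ∀ t ∈ Ici (0:ℝ), μ * (1 + ε t) ≤ C t - ε' t)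
    (hmuk : 0 < μ + Cbar / 2 - 2 * k)
    (ha' : 0 ≤ a')
    (ha'ε : 0 < a' + εbar / 2)
    (hg : Tendsto (fun T => ∫ t in (0:ℝ)..T, 1 / (C t - ε' t / 2 + 1)) atTop atTop)
    (hC' : (∀ t ∈ Ici (0:ℝ), C' t ≤ 0) ∨ Tendsto C' atTop (nhds 0))
    :
    ∃ κ, 0 ≤ κ ∧
      ∀ δ, 0 < δ → ∀ t₀, κ ≤ t₀ →
        ∃ β, 0 < β ∧
          ∀ S : ClassicalSolution ε C F a' t₀,
            (∀ x ∈ Icc (0:ℝ) π, ∀ t ∈ Ici t₀, S.aa x t ≤ A) →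
            S.d t₀ ≤ δ → ∀ t, t₀ ≤ t → S.d t < β := by
  have hFc : Continuous F := continuous_iff_continuousAt.2 fun z => (hFderiv z).continuousAt
  set Φ : ℝ → ℝ := fun z => ∫ s in (0:ℝ)..z, F s with hΦdef
  have hΦd : ∀ z, HasDerivAt Φ (F z) z := fun z =>
    intervalIntegral.integral_hasDerivAt_right (hFc.intervalIntegrable 0 z)
      hFc.stronglyMeasurable.stronglyMeasurableAtFilter hFc.continuousAt
  have hΦc : Continuous Φ := continuous_iff_continuousAt.2 fun z => (hΦd z).continuousAt
  have hΦk : ∀ z, Φ z ≤ k / 2 * z^2 := sb_Phi hFc (sb_F_sign hFderiv hF0 hFk)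
  have hCl : ∀ t, 0 < t → Cbar ≤ C t := fun t ht => hCbar.1 ⟨t, ht, rfl⟩
  have hεl : ∀ t, 0 < t → εbar ≤ ε t := fun t ht => hεbar.1 ⟨t, ht, rfl⟩
  have hel : ∀ t, 0 < t → ebar ≤ ε'' t := fun t ht => hebar.1 ⟨t, ht, rfl⟩
  have hεbar0 : 0 ≤ εbar := hεbar.2 (by
    rintro _ ⟨t, ht, rfl⟩
    exact hεnonneg t (mem_Ici.2 (le_of_lt ht)))
  obtain ⟨θ, hθa, hθk, hθ⟩ : ∃ θ : ℝ, a' ≤ θ ∧ 2 * k ≤ θ * μ ∧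
      3/2 - ebar / 2 + a' * Cbar / 2 ≤ θ * Cbar / 4 := by
    refine ⟨a' + 2 * k / μ + 4 / Cbar * |3/2 - ebar / 2 + a' * Cbar / 2|, ?_, ?_, ?_⟩
    · have : 0 ≤ 2 * k / μ + 4 / Cbar * |3/2 - ebar / 2 + a' * Cbar / 2| := by positivity
      linarith
    · have h1 : 0 ≤ (a' + 4 / Cbar * |3/2 - ebar / 2 + a' * Cbar / 2|) * μ := by positivity
      have h2 : 2 * k / μ * μ = 2 * k := by field_simp
      linarith
    · have h1 : 0 ≤ (a' + 2 * k / μ) * Cbar := by positivity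
      have h2 : 4 / Cbar * |3/2 - ebar / 2 + a' * Cbar / 2| * Cbar
        = 4 * |3/2 - ebar / 2 + a' * Cbar / 2| := by field_simp
      have h3 := le_abs_self (3/2 - ebar / 2 + a' * Cbar / 2)
      linarith
  have hθ0 : 0 ≤ θ := ha'.trans hθa
  obtain ⟨γ, hγ1, hγ2⟩ : ∃ γ : ℝ, 4 * θ^2 / Cbar + 2 ≤ γ ∧
      A^2 / (4*μ) + θ + θ^2 * A^2 / 4 ≤ γ * (a' + εbar / 2) := by
    refine ⟨4 * θ^2 / Cbar + 2 + (A^2 / (4*μ) + θ + θ^2 * A^2 / 4) / (a' + εbar / 2), ?_, ?_⟩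
    · have : 0 ≤ (A^2 / (4*μ) + θ + θ^2 * A^2 / 4) / (a' + εbar / 2) := by positivity
      linarith
    · have h1 : 0 ≤ (4 * θ^2 / Cbar + 2) * (a' + εbar / 2) := by positivity
      rw [add_mul, div_mul_cancel₀ _ ha'ε.ne']
      linarith
  have hγ0 : 0 ≤ γ := by
    have : 0 ≤ 4 * θ^2 / Cbar := by positivity
    linarith
  obtain ⟨κ₀, hκ₀⟩ : ∃ κ₀ : ℝ, ∀ t, 0 ≤ t → κ₀ ≤ t → (1 + γ) * C' t ≤ 1 := by
    rcases hC' with h | h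
    · refine ⟨0, fun t ht _ => ?_⟩
      have := mul_nonneg (show 0 ≤ 1 + γ by linarith) (neg_nonneg.2 (h t ht))
      linarith
    · have h1 : ∀ᶠ t in atTop, C' t < 1 / (1 + γ) :=
        h.eventually_lt_const (by positivity)
      obtain ⟨κ₀, h2⟩ := eventually_atTop.1 h1
      refine ⟨κ₀, fun t _ ht => ?_⟩
      have h3 := h2 t ht
      rw [lt_div_iff₀ (by positivity)] at h3
      linarith
  refine ⟨max 1 κ₀, le_trans zero_le_one (le_max_left _ _), ?_⟩
  intro δ hδ t₀ ht₀
  have ht1 : 1 ≤ t₀ := (le_max_left _ _).trans ht₀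
  have htk : κ₀ ≤ t₀ := (le_max_right _ _).trans ht₀
  obtain ⟨L, hL⟩ := (isCompact_Icc (a := -((π + δ^2) / 2)) (b := (π + δ^2) / 2)
    ).exists_bound_of_continuousOn hΦc.continuousOn
  have hL' : ∀ z, |z| ≤ (π + δ^2) / 2 → |Φ z| ≤ L := fun z hz => hL z (abs_le.1 hz)
  set K : ℝ → ℝ := fun t => (1+γ) * C t - ε' t + (a' + θ) * ε t with hKdef
  set B := (1 + γ / 2 + θ / 2 + θ * a' / 2 + |K t₀| / 2) * δ^2 + (1 + γ) * L * π with hB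
  refine ⟨Real.sqrt ((4 + 16 / Cbar) * B) + 1, by positivity, ?_⟩
  intro S hSA hSd t ht
  have hpos : ∀ s ∈ Ici t₀, 0 < s := fun s hs => lt_of_lt_of_le (by linarith) (mem_Ici.1 hs)
  have hnn : ∀ s ∈ Ici t₀, s ∈ Ici (0:ℝ) := fun s hs => mem_Ici.2 (hpos s hs).le
  have hsubI : Ici t₀ ⊆ Ici (0:ℝ) := hnn
  set v : ℝ → ℝ → ℝ := fun x t => 1/2 * (S.ut x t - ε t * S.uxx x t)^2 + γ / 2 * (S.ut x t)^2
      + θ * (S.u x t * S.ut x t) + θ * a' / 2 * (S.u x t)^2 - (1 + γ) * Φ (S.u x t)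
      - 1/2 * (K t * (S.u x t * S.uxx x t)) with hv
  set v' : ℝ → ℝ → ℝ := fun x t =>
      (S.ut x t - ε t * S.uxx x t) * (S.utt x t - (ε' t * S.uxx x t + ε t * S.uxxt x t))
      + γ * (S.ut x t * S.utt x t) + θ * (S.ut x t * S.ut x t + S.u x t * S.utt x t)
      + θ * a' * (S.u x t * S.ut x t)
      - (1 + γ) * (F (S.u x t) * S.ut x t)
      - 1/2 * (((1+γ) * C' t - ε'' t + (a' + θ) * ε' t) * (S.u x t * S.uxx x t)
        + K t * (S.ut x t * S.uxx x t + S.u x t * S.uxxt x t)) with hv'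
  have hKd : ∀ s ∈ Ici t₀,
      HasDerivWithinAt K ((1+γ) * C' s - ε'' s + (a' + θ) * ε' s) (Ici t₀) s := by
    intro s hs
    exact ((((hCderiv s (hnn s hs)).const_mul (1+γ)).sub (hε'deriv s (hnn s hs))).add
      ((hεderiv s (hnn s hs)).const_mul (a' + θ))).mono hsubI
  have hvd : ∀ x ∈ Icc (0:ℝ) π, ∀ s ∈ Ici t₀,
      HasDerivWithinAt (fun r => v x r) (v' x s) (Ici t₀) s := by
    intro x hx s hs
    have du := S.hut x hx s hs
    have dut := S.hutt x hx s hs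
    have duxx := S.huxxt x hx s hs
    have dε := (hεderiv s (hnn s hs)).mono hsubI
    have dΦ := (hΦd (S.u x s)).comp_hasDerivWithinAt s du
    have D := (((((((dut.sub (dε.mul duxx)).pow 2).const_mul (1/2)).add
      ((dut.pow 2).const_mul (γ / 2))).add ((du.mul dut).const_mul θ)).add
      ((du.pow 2).const_mul (θ * a' / 2))).sub (dΦ.const_mul (1 + γ))).sub
      (((hKd s hs).mul (du.mul duxx)).const_mul (1/2))
    refine D.congr_deriv ?_
    simp only [hv', Pi.mul_apply, Pi.sub_apply, Pi.pow_apply]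
    push_cast
    ring
  -- continuity on the space-time domain
  have lift : ∀ f : ℝ → ℝ, ContinuousOn f (Ici 0) →
      ContinuousOn (fun p : ℝ × ℝ => f p.2) (Icc 0 π ×ˢ Ici t₀) := fun f hf =>
    hf.comp continuousOn_snd (fun p hp => hnn _ hp.2)
  have cε := lift ε (fun s hs => (hεderiv s hs).continuousWithinAt)
  have cε' := lift ε' (fun s hs => (hε'deriv s hs).continuousWithinAt)
  have cε'' := lift ε'' hε''cont
  have cC := lift C (fun s hs => (hCderiv s hs).continuousWithinAt)
  have cC' := lift C' hC'cont
  have cK : ContinuousOn (fun p : ℝ × ℝ => K p.2) (Icc 0 π ×ˢ Ici t₀) :=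
    ((cC.const_smul (1+γ)).sub cε').add (cε.const_smul (a' + θ))
  have cu := S.cont_u
  have cuxx := S.cont_uxx
  have cut := S.cont_ut
  have cutt := S.cont_utt
  have cuxxt := S.cont_uxxt
  have cΦ := hΦc.comp_continuousOn cu
  have cF := hFc.comp_continuousOn cu
  have hvc : ContinuousOn (Function.uncurry v) (Icc 0 π ×ˢ Ici t₀) :=
    (((((((cut.sub (cε.mul cuxx)).pow 2).const_smul (1/2 : ℝ)).add
      ((cut.pow 2).const_smul (γ / 2))).add ((cu.mul cut).const_smul θ)).add
      ((cu.pow 2).const_smul (θ * a' / 2))).sub (cΦ.const_smul (1 + γ))).sub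
      ((cK.mul (cu.mul cuxx)).const_smul (1/2 : ℝ))
  have hv'c : ContinuousOn (Function.uncurry v') (Icc 0 π ×ˢ Ici t₀) :=
    ((((((cut.sub (cε.mul cuxx)).mul (cutt.sub ((cε'.mul cuxx).add (cε.mul cuxxt)))).add
      ((cut.mul cutt).const_smul γ)).add (((cut.mul cut).add (cu.mul cutt)).const_smul θ)).add
      ((cu.mul cut).const_smul (θ * a'))).sub ((cF.mul cut).const_smul (1 + γ))).sub
      ((((((cC'.const_smul (1+γ)).sub cε'').add (cε'.const_smul (a' + θ))).mul
        (cu.mul cuxx)).add (cK.mul ((cut.mul cuxx).add (cu.mul cuxxt)))).const_smul (1/2 : ℝ))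
  have hanti : AntitoneOn (fun s => ∫ x in (0:ℝ)..π, v x s) (Ici t₀) := by
    apply antitoneOn_of_hasDerivWithinAt_nonpos (f' := fun s => ∫ x in (0:ℝ)..π, v' x s)
      (convex_Ici t₀) (sb_param_cont hvc)
    · intro s hs
      rw [interior_Ici] at hs
      exact (sb_param_deriv (right_mem_Icc.2 Real.pi_pos.le) hvc hv'c hvd hs).hasDerivWithinAt
    · intro s hs
      rw [interior_Ici] at hs
      have hs' : s ∈ Ici t₀ := mem_Ici.2 (le_of_lt hs)
      obtain ⟨uxt, h1, h2⟩ := sb_uxt S hs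
      have hbd : ∀ b ∈ Icc (0:ℝ) π, (∀ r ∈ Ici t₀, S.u b r = 0) → S.ut b s = 0 := by
        intro b hb hz
        have d1 := (S.hut b hb s hs').hasDerivAt (Ici_mem_nhds hs)
        refine d1.unique ((hasDerivAt_const s (0:ℝ)).congr_of_eventuallyEq ?_)
        filter_upwards [Ici_mem_nhds hs] with r hr
        exact hz r hr
      have hsp := hpos s hs'
      have hνs : a' + εbar / 2 ≤ ε s + a' := by linarith [hεl s hsp]
      exact sb_static (S.hux s hs') (S.huxx s hs') h1 h2 (sb_slice cuxx hs') (sb_slice cuxxt hs')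
        (sb_slice cutt hs') (S.bc0 s hs') (S.bcπ s hs')
        (hbd 0 (left_mem_Icc.2 Real.pi_pos.le) S.bc0) (hbd π (right_mem_Icc.2 Real.pi_pos.le) S.bcπ)
        (fun x hx => S.aa_nonneg x hx s hs') (fun x hx => hSA x hx s hs')
        (fun x hx => S.pde x hx s hs) hFderiv hF'cont hF0 hFk (hεnonneg s hsp.le) hμ hk ha'
        hCbarpos (hCl s hsp) (hdiss s hsp.le) (hel s hsp) hmuk hνs hγ0 hγ2 hθa hθk hθ
        (hκ₀ s hsp.le (htk.trans hs'))
  have hm : t₀ ∈ Ici t₀ := mem_Ici.2 le_rfl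
  have hd0 : ∫ x in (0:ℝ)..π, ((ε t₀)^2 * (S.uxx x t₀)^2 + (S.ux x t₀)^2 + (S.u x t₀)^2
      + (S.ut x t₀)^2) ≤ δ^2 := by
    unfold ClassicalSolution.d at hSd
    exact (Real.sqrt_le_left hδ.le).1 hSd
  have hup := sb_upper (K := K t₀) (γ := γ) (θ := θ) (S.hux t₀ hm) (S.huxx t₀ hm)
    (sb_slice cuxx le_rfl) (sb_slice cut le_rfl) (S.bc0 t₀ hm) (S.bcπ t₀ hm) hΦc hL' ha' hθ0 hγ0 hd0
  have htp := hpos t ht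
  have hlow := sb_lower (F := F) (θ := θ) (S.hux t ht) (S.huxx t ht) (sb_slice cuxx ht)
    (sb_slice cut ht) (S.bc0 t ht) (S.bcπ t ht) hΦc hΦk (hεnonneg t htp.le) hk ha' hCbarpos hCk hμ
    (hCl t htp) (hdiss t htp.le) hmuk hθ0 hγ1
  have hmid : ∫ x in (0:ℝ)..π, v x t ≤ ∫ x in (0:ℝ)..π, v x t₀ := hanti hm ht ht
  have hfin : ∫ x in (0:ℝ)..π, ((ε t)^2 * (S.uxx x t)^2 + (S.ux x t)^2 + (S.u x t)^2
      + (S.ut x t)^2) ≤ (4 + 16 / Cbar) * B := by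
    refine le_trans hlow (mul_le_mul_of_nonneg_left ?_ (by positivity))
    exact le_trans hmid hup
  unfold ClassicalSolution.d
  exact lt_of_le_of_lt (Real.sqrt_le_sqrt hfin) (lt_add_one _)
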